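/- There exists n₀ such that for every even n ≥ n₀ and every Boolean function h : 𝔽₂ⁿ → 𝔽₂ the following holds, where p = |{z : h(z) = 1}|/2ⁿ, L = 10·2^{n/2}, and t = 2^{−L}·e^{9/√2}: if gap(h)² ≥ 2^{n−1} then p^L + (1−p)^L ≥ t, while if gap(h)² ≤ 2^{n−2} then p^L + (1−p)^L ≤ (2/3)·t. (Here p^L + (1−p)^L is the probability that L independent uniformly random queries to h all return the same value.) -/

import Mathlib

/-- The gap of a Boolean function `h : 𝔽₂ⁿ → 𝔽₂`:
`gap h = ∑_x (−1)^{h(x)}`. -/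
def gap {n : ℕ} (h : (Fin n → ZMod 2) → ZMod 2) : ℤ :=
  ∑ x : Fin n → ZMod 2, if h x = 0 then 1 else -1

theorem gap_eq_two_pow_sub_two_mul_card {n : ℕ} (h : (Fin n → ZMod 2) → ZMod 2) :
    gap h = 2 ^ n - 2 * ((Finset.univ.filter (fun z => h z = 1)).card : ℤ) := by
  have hterm : ∀ x, (if h x = 0 then (1 : ℤ) else -1) = 1 - 2 * (if h x = 1 then 1 else 0) := by
    have hbit : ∀ a : ZMod 2,
        (if a = 0 then (1 : ℤ) else -1) = 1 - 2 * (if a = 1 then 1 else 0) := by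
      decide
    exact fun x => hbit (h x)
  simp only [gap, hterm, Finset.sum_sub_distrib, ← Finset.mul_sum, Finset.sum_boole]
  simp [ZMod.card]

theorem one_add_abs_pow_le {d : ℝ} (hd : |d| ≤ 1) (L : ℕ) :
    (1 + |d|) ^ L ≤ (1 - d) ^ L + (1 + d) ^ L := by
  obtain ⟨h₁, h₂⟩ := abs_le.mp hd
  have h₃ : 0 ≤ (1 - d) ^ L := pow_nonneg (by linarith) L
  have h₄ : 0 ≤ (1 + d) ^ L := pow_nonneg (by linarith) L
  rcases abs_cases d with ⟨h, _⟩ | ⟨h, _⟩ <;> rw [h]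
  · linarith
  · rw [← sub_eq_add_neg]
    linarith

theorem pow_add_pow_le_one_add_abs_pow {d : ℝ} (hd : |d| ≤ 1) (L : ℕ) :
    (1 - d) ^ L + (1 + d) ^ L ≤ 1 + (1 + |d|) ^ L := by
  obtain ⟨h₁, h₂⟩ := abs_le.mp hd
  rcases abs_cases d with ⟨h, _⟩ | ⟨h, _⟩ <;> rw [h]
  · have : (1 - d) ^ L ≤ 1 := pow_le_one₀ (by linarith) (by linarith)
    linarith
  · have : (1 + d) ^ L ≤ 1 := pow_le_one₀ (by linarith) (by linarith)
    rw [← sub_eq_add_neg]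
    linarith

theorem exp_nine_tenths_mul_le_one_add {x : ℝ} (h₀ : 0 ≤ x) (h₁ : x ≤ 1 / 9) :
    Real.exp (9 / 10 * x) ≤ 1 + x := by
  rw [← Real.le_log_iff_exp_le (by linarith)]
  refine le_trans ?_ (Real.one_sub_inv_le_log_of_pos (by linarith))
  rw [← sub_nonneg]
  have h : 1 - (1 + x)⁻¹ - 9 / 10 * x = x * (1 / 10 - 9 / 10 * x) / (1 + x) := by
    field_simp
    ring
  rw [h]
  exact div_nonneg (mul_nonneg h₀ (by linarith)) (by linarith)

theorem exp_nine_div_sqrt_two_le {d : ℝ} {N : ℕ} (hN : 8 ≤ N)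
    (hd : 1 / 2 ≤ (d * N) ^ 2) :
    Real.exp (9 / √2) ≤ (1 + |d|) ^ (10 * N) := by
  have hN' : (8 : ℝ) ≤ N := by exact_mod_cast hN
  have hs : (0 : ℝ) < √2 := by positivity
  have hs₁ : (√2) ^ 2 = (2 : ℝ) := Real.sq_sqrt (by norm_num)
  have hs₂ : (9 / 8 : ℝ) ≤ √2 := Real.le_sqrt_of_sq_le (by norm_num)
  have hx : 1 / (√2 * N) ≤ |d| := by
    rw [div_le_iff₀ (by positivity)]
    have h : (1 : ℝ) ^ 2 ≤ (d * (√2 * N)) ^ 2 := by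
      have : (d * (√2 * N)) ^ 2 = √2 ^ 2 * (d * N) ^ 2 := by ring
      rw [this, hs₁]
      linarith
    have h' := sq_le_sq.mp h
    rwa [abs_one, abs_mul, abs_of_nonneg (by positivity : (0 : ℝ) ≤ √2 * N)] at h'
  have hx₁ : 1 / (√2 * N) ≤ 1 / 9 := by
    apply one_div_le_one_div_of_le (by norm_num)
    nlinarith
  have hexp : Real.exp (9 / √2) = Real.exp (9 / 10 * (1 / (√2 * N))) ^ (10 * N) := by
    rw [← Real.exp_nat_mul]
    congr 1
    push_cast
    field_simp
  rw [hexp]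
  have := exp_nine_tenths_mul_le_one_add (x := 1 / (√2 * N)) (by positivity) hx₁
  exact pow_le_pow_left₀ (Real.exp_nonneg _) (by linarith) _

theorem one_add_abs_pow_le_exp_five {d : ℝ} {N : ℕ} (hd : (d * N) ^ 2 ≤ 1 / 4) :
    (1 + |d|) ^ (10 * N) ≤ Real.exp 5 := by
  have h : |d| * N ≤ 1 / 2 := by
    have h' : (d * N) ^ 2 ≤ (1 / 2 : ℝ) ^ 2 := by linarith
    have := sq_le_sq.mp h'
    rwa [abs_mul, Nat.abs_cast, abs_of_pos (by norm_num : (0 : ℝ) < 1 / 2)] at this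
  calc (1 + |d|) ^ (10 * N) ≤ Real.exp |d| ^ (10 * N) := by
        refine pow_le_pow_left₀ (by positivity) ?_ _
        linarith [Real.add_one_le_exp |d|]
    _ = Real.exp ((10 * N : ℕ) * |d|) := (Real.exp_nat_mul _ _).symm
    _ ≤ Real.exp 5 := by
        apply Real.exp_le_exp.mpr
        push_cast
        linarith

theorem one_add_exp_five_le : 1 + Real.exp 5 ≤ 2 / 3 * Real.exp (9 / √2) := by
  have hs : √2 ≤ (3 / 2 : ℝ) := Real.sqrt_le_iff.mpr (by norm_num)
  have h₆ : Real.exp 6 ≤ Real.exp (9 / √2) := by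
    apply Real.exp_le_exp.mpr
    rw [le_div_iff₀ (by positivity)]
    linarith
  have h₅ : Real.exp 6 = Real.exp 5 * Real.exp 1 := by
    rw [← Real.exp_add]
    norm_num
  have := Real.exp_one_gt_d9
  have := Real.add_one_le_exp (5 : ℝ)
  nlinarith

/-- for all sufficiently large even `n` and every Boolean function `h`,
with `p` the fraction of ones of `h`, `L = 10·2^{n/2}` and `t = 2^{−L} e^{9/√2}`:
if `gap(h)² ≥ 2^{n−1}` then `p^L + (1−p)^L ≥ t`, while if `gap(h)² ≤ 2^{n−2}` then
`p^L + (1−p)^L ≤ (2/3)·t`. -/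
theorem stmt19 :
    ∃ n₀ : ℕ, ∀ n : ℕ, n₀ ≤ n → Even n →
      ∀ h : (Fin n → ZMod 2) → ZMod 2,
        let p : ℝ :=
          ((Finset.univ.filter (fun z : Fin n → ZMod 2 => h z = 1)).card : ℝ) / 2 ^ n
        let L : ℕ := 10 * 2 ^ (n / 2)
        let t : ℝ := ((2 : ℝ) ^ L)⁻¹ * Real.exp (9 / Real.sqrt 2)
        ((2 : ℤ) ^ (n - 1) ≤ (gap h) ^ 2 → t ≤ p ^ L + (1 - p) ^ L) ∧
        ((gap h) ^ 2 ≤ (2 : ℤ) ^ (n - 2) → p ^ L + (1 - p) ^ L ≤ (2 / 3) * t) := by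
  refine ⟨6, fun n hn hev h => ?_⟩
  intro p L t
  obtain ⟨m, rfl⟩ := hev
  have hm : (m + m) / 2 = m := by omega
  have hN : 8 ≤ 2 ^ m := Nat.pow_le_pow_right two_pos (by omega : 3 ≤ m)
  have hpow : (2 : ℝ) ^ (m + m) = 2 ^ m * 2 ^ m := pow_add _ _ _
  have hpos : (0 : ℝ) < 2 ^ m := by positivity
  have hL : L = 10 * 2 ^ m := by simp only [L, hm]
  obtain ⟨d, hd⟩ : ∃ d : ℝ, d = gap h / 2 ^ (m + m) := ⟨_, rfl⟩
  have hp : p = (1 - d) / 2 := by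
    rw [hd, gap_eq_two_pow_sub_two_mul_card]
    simp only [p]
    push_cast
    field_simp
    ring
  have hp₀ : 0 ≤ p := by positivity
  have hp₁ : p ≤ 1 := by
    simp only [p]
    rw [div_le_one (by positivity)]
    have := Finset.card_filter_le Finset.univ (fun z : Fin (m + m) → ZMod 2 => h z = 1)
    simp only [Finset.card_univ, Fintype.card_fun, ZMod.card, Fintype.card_fin] at this
    exact_mod_cast this
  have hd₁ : |d| ≤ 1 := abs_le.mpr ⟨by linarith, by linarith⟩
  have hdN : (d * (2 ^ m : ℕ)) ^ 2 = (gap h : ℝ) ^ 2 / 2 ^ (m + m) := by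
    rw [hd, hpow]
    push_cast
    field_simp
  have hsum : p ^ L + (1 - p) ^ L = ((2 : ℝ) ^ L)⁻¹ * ((1 - d) ^ L + (1 + d) ^ L) := by
    have hq : 1 - p = (1 + d) / 2 := by rw [hp]; ring
    rw [hq, hp, div_pow, div_pow]
    ring
  rw [hsum]
  constructor
  · intro hgap
    have hgap' : (2 : ℝ) ^ (m + m - 1) ≤ (gap h : ℝ) ^ 2 := by exact_mod_cast hgap
    have h2 : (2 : ℝ) ^ (m + m) = 2 * 2 ^ (m + m - 1) := by
      rw [← pow_succ']
      congr 1
      omega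
    refine mul_le_mul_of_nonneg_left ?_ (by positivity)
    refine le_trans ?_ (one_add_abs_pow_le hd₁ L)
    rw [hL]
    apply exp_nine_div_sqrt_two_le hN
    rw [hdN, le_div_iff₀ (by positivity)]
    linarith
  · intro hgap
    have hgap' : (gap h : ℝ) ^ 2 ≤ (2 : ℝ) ^ (m + m - 2) := by exact_mod_cast hgap
    have h4 : (2 : ℝ) ^ (m + m) = 4 * 2 ^ (m + m - 2) := by
      rw [show (4 : ℝ) = 2 ^ 2 by norm_num, ← pow_add]
      congr 1
      omega
    rw [show 2 / 3 * t = ((2 : ℝ) ^ L)⁻¹ * (2 / 3 * Real.exp (9 / √2)) by simp only [t]; ring]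
    refine mul_le_mul_of_nonneg_left ?_ (by positivity)
    refine le_trans (pow_add_pow_le_one_add_abs_pow hd₁ L) ?_
    refine le_trans ?_ one_add_exp_five_le
    rw [hL]
    gcongr
    apply one_add_abs_pow_le_exp_five
    rw [hdN, div_le_iff₀ (by positivity)]
    linarith
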